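/- Let V be an n-vertex set with a partition V = V₁ ∪ ⋯ ∪ V_k, let 0 < q < p ≤ 3/4 with p·n ≥ 1, and set s̄ := 2^13·√(p(1−q)·n)·log n/(p−q). Let W ⊆ V be a fixed subset and let the edges among W be present independently: with probability p if both endpoints lie in the same cluster and with probability q otherwise. Let T₁ ⊆ W be a fixed subset (chosen independently of the edges among W) with |T₁| ≥ s′/6 for some s′ ≥ 0.48·s̄, and suppose there is a cluster V_j with T₁ ∩ V_j ≠ ∅ and |T₁ ∩ V_j| ≤ |T₁|/2. Then with probability at least 1 − n^{−8}, there exists a vertex v ∈ T₁ with N_{T₁}(v) < (0.9p + 0.1q)·|T₁|. -/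

import Mathlib

open MeasureTheory

noncomputable def bern (p : ℝ) : Measure Bool :=
  ENNReal.ofReal p • Measure.dirac true + ENNReal.ofReal (1 - p) • Measure.dirac false

noncomputable def sbm (n k : ℕ) (c : Fin n → Fin k) (p q : ℝ) :
    Measure ({e : Fin n × Fin n // e.1 < e.2} → Bool) :=
  Measure.pi fun e => bern (if c e.1.1 = c e.1.2 then p else q)

def clusterF {n k : ℕ} (c : Fin n → Fin k) (i : Fin k) : Finset (Fin n) :=
  Finset.univ.filter fun v => c v = i

def adjB {n : ℕ} (G : {e : Fin n × Fin n // e.1 < e.2} → Bool) (u v : Fin n) : Bool :=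
  if h : u < v then G ⟨(u, v), h⟩ else if h' : v < u then G ⟨(v, u), h'⟩ else false

/-- `N_S(v)`: the number of neighbors of `v` in `S` (not counting `v` itself). -/
def nbr {n : ℕ} (G : {e : Fin n × Fin n // e.1 < e.2} → Bool) (S : Finset (Fin n)) (v : Fin n) :
    ℕ :=
  (S.filter fun u => adjB G u v = true).card

/-- `s̄ := 2^13·√(p(1−q)·n)·log n/(p−q)`. -/
noncomputable def sbar (n : ℕ) (p q : ℝ) : ℝ :=
  2 ^ 13 * Real.sqrt (p * (1 - q) * n) * Real.log n / (p - q)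

instance bern_isFiniteMeasure (p : ℝ) : IsFiniteMeasure (bern p) := by
  constructor
  simp [bern, ENNReal.add_lt_top]

theorem bern_isProbabilityMeasure {p : ℝ} (h0 : 0 ≤ p) (h1 : p ≤ 1) :
    IsProbabilityMeasure (bern p) := by
  constructor
  simp only [bern, Measure.add_apply, Measure.smul_apply, measure_univ, smul_eq_mul, mul_one]
  rw [← ENNReal.ofReal_add h0 (by linarith)]
  simp

theorem integral_bern {p : ℝ} (h0 : 0 ≤ p) (h1 : p ≤ 1) (f : Bool → ℝ) :
    ∫ b, f b ∂bern p = p * f true + (1 - p) * f false := by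
  have hfin (a : ℝ) (b : Bool) : Integrable f (ENNReal.ofReal a • Measure.dirac b) :=
    (integrable_dirac (by simp)).smul_measure (by simp)
  rw [bern, integral_add_measure (hfin _ _) (hfin _ _), integral_smul_measure,
    integral_smul_measure, integral_dirac, integral_dirac, ENNReal.toReal_ofReal h0,
    ENNReal.toReal_ofReal (by linarith)]
  simp

/-- Chernoff bound for a sum of independent Bernoulli variables. -/
theorem bern_pi_card_tail_le {ι : Type*} [Fintype ι] (r : ι → ℝ)
    (hr : ∀ e, 0 ≤ r e ∧ r e ≤ 1) (E : Finset ι) {s : ℝ} (hs : 0 ≤ s) (t : ℝ) :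
    (Measure.pi fun e => bern (r e)).real
        {G | t ≤ ((E.filter fun e => G e = true).card : ℝ)} ≤
      Real.exp (-s * t + (Real.exp s - 1) * ∑ e ∈ E, r e) := by
  classical
  have hprob : ∀ e, IsProbabilityMeasure (bern (r e)) :=
    fun e => bern_isProbabilityMeasure (hr e).1 (hr e).2
  refine (ProbabilityTheory.measure_ge_le_exp_mul_mgf t hs (by simp)).trans ?_
  rw [Real.exp_add]
  refine mul_le_mul_of_nonneg_left ?_ (Real.exp_pos _).le
  have hexp (G : ι → Bool) : Real.exp (s * ((E.filter fun e => G e = true).card : ℝ)) =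
      ∏ e, (fun b : Bool => if e ∈ E ∧ b = true then Real.exp s else 1) (G e) := by
    rw [Finset.prod_ite, Finset.prod_const_one, mul_one, Finset.prod_const, ← Real.exp_nat_mul,
      mul_comm s]
    congr 4
    ext e
    simp
  simp only [ProbabilityTheory.mgf, hexp]
  rw [integral_fintype_prod_eq_prod
    (f := fun e (b : Bool) => if e ∈ E ∧ b = true then Real.exp s else 1)]
  have hsum : (Real.exp s - 1) * ∑ e ∈ E, r e =
      ∑ e, if e ∈ E then (Real.exp s - 1) * r e else 0 := by
    rw [Finset.mul_sum, Finset.sum_ite_mem, Finset.univ_inter]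
  rw [hsum, Real.exp_sum]
  refine Finset.prod_le_prod
    (fun e _ => integral_nonneg fun b => by dsimp only; split_ifs <;> positivity) fun e _ => ?_
  rw [integral_bern (hr e).1 (hr e).2]
  by_cases he : e ∈ E
  · simp only [he, and_self, ↓reduceIte, Bool.false_eq_true, and_false]
    linarith [Real.add_one_le_exp ((Real.exp s - 1) * r e)]
  · simp [he]

/-- The unordered pair `{u, v}`, as a coordinate of the random graph. -/
def pairWith {n : ℕ} (v : Fin n) (u : {u : Fin n // u ≠ v}) :
    {e : Fin n × Fin n // e.1 < e.2} :=
  if h : u.1 < v then ⟨(u.1, v), h⟩ else ⟨(v, u.1), lt_of_le_of_ne (not_lt.mp h) u.2.symm⟩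

theorem pairWith_injective {n : ℕ} (v : Fin n) : Function.Injective (pairWith v) := by
  rintro ⟨u, hu⟩ ⟨w, hw⟩ h
  unfold pairWith at h
  split_ifs at h <;> simp_all

theorem adjB_eq_pairWith {n : ℕ} (G : {e : Fin n × Fin n // e.1 < e.2} → Bool) (v : Fin n)
    (u : {u : Fin n // u ≠ v}) : adjB G u v = G (pairWith v u) := by
  unfold adjB pairWith
  split_ifs with h1 h2
  · rfl
  · rfl
  · exact absurd (le_antisymm (not_lt.mp h2) (not_lt.mp h1)) u.2

/-- The potential edges joining `v` to the other vertices of `S`. -/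
def starEdges {n : ℕ} (S : Finset (Fin n)) (v : Fin n) :
    Finset {e : Fin n × Fin n // e.1 < e.2} :=
  (S.subtype (· ≠ v)).map ⟨pairWith v, pairWith_injective v⟩

theorem nbr_eq_card_starEdges {n : ℕ} (G : {e : Fin n × Fin n // e.1 < e.2} → Bool)
    (S : Finset (Fin n)) (v : Fin n) :
    nbr G S v = ((starEdges S v).filter fun e => G e = true).card := by
  rw [starEdges, Finset.filter_map, Finset.card_map, nbr]
  symm
  refine Finset.card_bij (fun u _ => u.1) ?_ (fun _ _ _ _ h => Subtype.ext h) ?_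
  · intro u hu
    simp only [Finset.mem_filter, Finset.mem_subtype, Function.comp_apply,
      Function.Embedding.coeFn_mk] at hu
    simpa [adjB_eq_pairWith] using hu
  · intro u hu
    rw [Finset.mem_filter] at hu
    have huv : u ≠ v := by
      rintro rfl
      simp [adjB] at hu
    refine ⟨⟨u, huv⟩, ?_, rfl⟩
    simpa [← adjB_eq_pairWith] using hu

theorem sum_starEdges_le {n k : ℕ} (c : Fin n → Fin k) {p q : ℝ} (hp : 0 ≤ p) (hq : 0 ≤ q)
    (S : Finset (Fin n)) (v : Fin n) :
    ∑ e ∈ starEdges S v, (if c e.1.1 = c e.1.2 then p else q) ≤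
      (S ∩ clusterF c (c v)).card * p + (S.card - (S ∩ clusterF c (c v)).card) * q := by
  have hpair (u : {u : Fin n // u ≠ v}) :
      (if c (pairWith v u).1.1 = c (pairWith v u).1.2 then p else q) =
        if c u.1 = c v then p else q := by
    unfold pairWith
    split_ifs <;> simp_all
  rw [starEdges, Finset.sum_map]
  simp only [Function.Embedding.coeFn_mk, hpair]
  have hcluster : S.filter (fun u => c u = c v) = S ∩ clusterF c (c v) := by
    ext u
    simp [clusterF]
  have hsplit := Finset.card_filter_add_card_filter_not (s := S) fun u => c u = c v
  rw [Finset.sum_subtype_eq_sum_filter (f := fun u => if c u = c v then p else q)]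
  refine (Finset.sum_le_sum_of_subset_of_nonneg (Finset.filter_subset _ S)
    fun u _ _ => by split_ifs <;> assumption).trans_eq ?_
  rw [Finset.sum_ite, Finset.sum_const, Finset.sum_const, nsmul_eq_mul, nsmul_eq_mul,
    ← hcluster, ← hsplit]
  push_cast
  ring

theorem exp_sub_one_le_add_sq {s : ℝ} (h0 : 0 ≤ s) (h1 : s ≤ 1) :
    Real.exp s - 1 ≤ s + s ^ 2 := by
  have h := abs_le.mp (Real.abs_exp_sub_one_sub_id_le (abs_le.mpr ⟨by linarith, h1⟩))
  linarith [h.2]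

/-- The Chernoff exponent at `s = 1 / √(pn)`. -/
theorem chernoff_exponent_le {n : ℕ} {p q t m : ℝ} (hq : 0 < q) (hpq : q < p) (hp : p ≤ 3 / 4)
    (hpn : 1 ≤ p * n) (htn : t ≤ n) (ht : 0.08 * sbar n p q ≤ t)
    (hm : m ≤ (p + q) / 2 * t) :
    -(1 / √(p * n)) * ((0.9 * p + 0.1 * q) * t) + (Real.exp (1 / √(p * n)) - 1) * m ≤
      -(8 * Real.log n) := by
  have hp0 : 0 < p := hq.trans hpq
  have hn : (4 : ℝ) / 3 ≤ n := by nlinarith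
  have hn2 : (2 : ℝ) ≤ n := by
    have : 1 < n := by exact_mod_cast (by linarith : (1 : ℝ) < n)
    exact_mod_cast this
  have hlog : 0.69 ≤ Real.log n := by
    have := Real.log_le_log (by norm_num) hn2
    linarith [Real.log_two_gt_d9]
  set R := √(p * n) with hR
  have hR1 : 1 ≤ R := Real.one_le_sqrt.mpr hpn
  have hRsq : R ^ 2 = p * n := Real.sq_sqrt (by linarith)
  have hsqrt : R / 2 ≤ √(p * (1 - q) * n) := by
    refine Real.le_sqrt_of_sq_le ?_
    nlinarith
  have hgap : 300 * R * Real.log n ≤ (p - q) * t := by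
    have hd : 0 < p - q := by linarith
    rw [sbar, ← mul_div_assoc, div_le_iff₀ hd] at ht
    have := mul_le_mul_of_nonneg_right hsqrt (by linarith : 0 ≤ Real.log n)
    nlinarith
  set s := 1 / R with hs
  have hs0 : 0 < s := by positivity
  have hs1 : s ≤ 1 := by rw [hs, div_le_one (by linarith)]; exact hR1
  have hsR : s * R = 1 := by rw [hs]; field_simp
  have ht0 : 0 ≤ t := by
    have : 0 ≤ (p - q) * t := le_trans (by positivity) hgap
    exact nonneg_of_mul_nonneg_right this (by linarith)
  have hexp := exp_sub_one_le_add_sq hs0.le hs1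
  have hexp0 : 0 ≤ Real.exp s - 1 := by linarith [Real.add_one_le_exp s]
  set M := (p + q) / 2 * t with hM
  have hM0 : 0 ≤ M := by positivity
  have hMR : M ≤ R ^ 2 := by
    rw [hRsq, hM]
    exact mul_le_mul (by linarith) htn ht0 hp0.le
  have h1 : (Real.exp s - 1) * m ≤ (s + s ^ 2) * M :=
    (mul_le_mul_of_nonneg_left hm hexp0).trans (mul_le_mul_of_nonneg_right hexp hM0)
  have h2 : s ^ 2 * M ≤ 1 := by
    calc s ^ 2 * M ≤ s ^ 2 * R ^ 2 := by gcongr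
      _ = 1 := by rw [← mul_pow, hsR, one_pow]
  have h3 : 300 * Real.log n ≤ s * ((p - q) * t) := by
    calc 300 * Real.log n = s * (300 * R * Real.log n) := by
          linear_combination -300 * Real.log n * hsR
      _ ≤ _ := by gcongr
  have h4 : s * ((0.9 * p + 0.1 * q) * t) - s * M = 0.4 * (s * ((p - q) * t)) := by
    rw [hM]; ring
  linarith

/-- Let `T₁ ⊆ W ⊆ V` be fixed with `|T₁| ≥ s′/6` for some `s′ ≥ 0.48·s̄`, and
suppose there is a cluster `V_j` with `T₁ ∩ V_j ≠ ∅` and `|T₁ ∩ V_j| ≤ |T₁|/2`. Then with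
probability at least `1 − n^{−8}`, some vertex `v ∈ T₁` has
`N_{T₁}(v) < (0.9p + 0.1q)|T₁|`. -/
theorem statement_13
    (n k : ℕ) (c : Fin n → Fin k) (p q s' : ℝ)
    (hq : 0 < q) (hpq : q < p) (hp : p ≤ 3 / 4) (hpn : 1 ≤ p * n)
    (W T₁ : Finset (Fin n)) (hTW : T₁ ⊆ W)
    (hs' : 0.48 * sbar n p q ≤ s')
    (hT₁ : s' / 6 ≤ (T₁.card : ℝ))
    (hj : ∃ j : Fin k, (T₁ ∩ clusterF c j).Nonempty ∧
      ((T₁ ∩ clusterF c j).card : ℝ) ≤ (T₁.card : ℝ) / 2) :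
    ENNReal.ofReal (1 - 1 / (n : ℝ) ^ 8) ≤
      sbm n k c p q
        {G | ∃ v ∈ T₁, (nbr G T₁ v : ℝ) < (0.9 * p + 0.1 * q) * (T₁.card : ℝ)} := by
  obtain ⟨j, ⟨v, hv⟩, hcard⟩ := hj
  obtain ⟨hvT, hvj⟩ := Finset.mem_inter.mp hv
  obtain rfl : c v = j := (Finset.mem_filter.mp hvj).2
  have hp0 : 0 < p := hq.trans hpq
  have hr : ∀ e : {e : Fin n × Fin n // e.1 < e.2},
      0 ≤ (if c e.1.1 = c e.1.2 then p else q) ∧ (if c e.1.1 = c e.1.2 then p else q) ≤ 1 := by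
    intro e
    split_ifs <;> constructor <;> linarith
  have hprob : ∀ e : {e : Fin n × Fin n // e.1 < e.2},
      IsProbabilityMeasure (bern (if c e.1.1 = c e.1.2 then p else q)) :=
    fun e => bern_isProbabilityMeasure (hr e).1 (hr e).2
  have hsbm : IsProbabilityMeasure (sbm n k c p q) := by
    unfold sbm
    infer_instance
  have hn : (0 : ℝ) < n := by
    by_contra h
    nlinarith
  have htn : (T₁.card : ℝ) ≤ n := by
    exact_mod_cast (Finset.card_le_univ T₁).trans_eq (Fintype.card_fin n)
  have hmean : ∑ e ∈ starEdges T₁ v, (if c e.1.1 = c e.1.2 then p else q) ≤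
      (p + q) / 2 * T₁.card := by
    refine (sum_starEdges_le c hp0.le hq.le T₁ v).trans ?_
    nlinarith
  have htail := bern_pi_card_tail_le (fun e => if c e.1.1 = c e.1.2 then p else q) hr
    (starEdges T₁ v) (s := 1 / √(p * n)) (by positivity) ((0.9 * p + 0.1 * q) * T₁.card)
  have hexponent := chernoff_exponent_le hq hpq hp hpn htn (by linarith) hmean
  have hpow : Real.exp (-(8 * Real.log n)) = 1 / (n : ℝ) ^ 8 := by
    rw [Real.exp_neg, one_div, ← Real.exp_log (pow_pos hn 8), Real.log_pow]
    norm_num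
  have hbad := htail.trans ((Real.exp_le_exp.mpr hexponent).trans_eq hpow)
  simp only [← nbr_eq_card_starEdges] at hbad
  change (sbm n k c p q).real _ ≤ _ at hbad
  refine ENNReal.ofReal_le_of_le_toReal ?_
  have hcompl := probReal_compl_eq_one_sub (μ := sbm n k c p q)
    (s := {G | (0.9 * p + 0.1 * q) * (T₁.card : ℝ) ≤ (nbr G T₁ v : ℝ)})
    (Set.toFinite _).measurableSet
  calc 1 - 1 / (n : ℝ) ^ 8 ≤ (sbm n k c p q).real
        {G | (0.9 * p + 0.1 * q) * (T₁.card : ℝ) ≤ (nbr G T₁ v : ℝ)}ᶜ := by linarith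
    _ ≤ (sbm n k c p q).real
        {G | ∃ v ∈ T₁, (nbr G T₁ v : ℝ) < (0.9 * p + 0.1 * q) * (T₁.card : ℝ)} :=
      measureReal_mono fun G hG => ⟨v, hvT, not_le.mp hG⟩
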